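/- Gaussian mechanism on ℝ: let 0 < ε ≤ 1, 0 < δ < 1, and Δ > 0, and let σ ≥ Δ·√(2·log(1.25/δ))/ε. Then for any two real inputs x, x' with |x − x'| ≤ Δ, and for every measurable set S ⊆ ℝ, the Gaussian output distributions satisfy N(x, σ²)(S) ≤ exp(ε)·N(x', σ²)(S) + δ, where N(m, σ²) denotes the Gaussian probability measure on ℝ with mean m and variance σ². -/

import Mathlib

open MeasureTheory ProbabilityTheory

lemma gaussianReal_Ioi_zero_le_half :
    gaussianReal 0 1 (Set.Ioi 0) ≤ ENNReal.ofReal (1 / 2) := by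
  have hneg : gaussianReal 0 1 (Set.Iio 0) = gaussianReal 0 1 (Set.Ioi 0) := by
    have h := gaussianReal_map_neg (μ := 0) (v := 1)
    rw [neg_zero] at h
    conv_lhs => rw [← h]
    rw [Measure.map_apply measurable_neg measurableSet_Iio]
    congr 1
    ext y
    simp
  have hdisj : Disjoint (Set.Iio (0 : ℝ)) (Set.Ioi 0) :=
    Set.disjoint_left.mpr fun y hy hy' ↦ lt_asymm (Set.mem_Iio.mp hy) hy'
  have h := measure_union (μ := gaussianReal 0 1) hdisj measurableSet_Ioi
  have hle : gaussianReal 0 1 (Set.Iio (0 : ℝ) ∪ Set.Ioi 0) ≤ 1 := prob_le_one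
  rw [h, hneg] at hle
  rw [← ENNReal.ofReal_toReal (measure_ne_top (gaussianReal 0 1) (Set.Ioi 0))] at hle ⊢
  rw [← ENNReal.ofReal_add ENNReal.toReal_nonneg ENNReal.toReal_nonneg,
    ENNReal.ofReal_le_one] at hle
  exact ENNReal.ofReal_le_ofReal (by linarith)

/-- If the density of one Gaussian is at most `c` times that of another on `s`, the same holds
for the measures of `s`. -/
lemma gaussianReal_le_mul_of_pdf_le {m m' c : ℝ} {v : NNReal} (hv : v ≠ 0) (hc : 0 ≤ c)
    {s : Set ℝ} (hs : MeasurableSet s)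
    (h : ∀ y ∈ s, gaussianPDFReal m v y ≤ c * gaussianPDFReal m' v y) :
    gaussianReal m v s ≤ ENNReal.ofReal c * gaussianReal m' v s := by
  rw [gaussianReal_apply _ hv, gaussianReal_apply _ hv,
    ← lintegral_const_mul _ (measurable_gaussianPDF m' v)]
  refine setLIntegral_mono' hs fun y hy ↦ ?_
  rw [gaussianPDF, gaussianPDF, ← ENNReal.ofReal_mul hc]
  exact ENNReal.ofReal_le_ofReal (h y hy)

lemma gaussianPDFReal_le_exp_mul {m m' a y : ℝ} {v : NNReal}
    (h : -(y - m) ^ 2 / (2 * v) ≤ a + -(y - m') ^ 2 / (2 * v)) :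
    gaussianPDFReal m v y ≤ Real.exp a * gaussianPDFReal m' v y := by
  rw [gaussianPDFReal, gaussianPDFReal, mul_left_comm, ← Real.exp_add]
  gcongr

lemma gaussianReal_Ioi_le_of_nonneg {t : ℝ} (ht : 0 ≤ t) :
    gaussianReal 0 1 (Set.Ioi t) ≤ ENNReal.ofReal (Real.exp (-t ^ 2 / 2) * (1 / 2)) := by
  have hshift : gaussianReal 0 1 (Set.Ioi t) = gaussianReal (-t) 1 (Set.Ioi 0) := by
    have h := gaussianReal_map_add_const (μ := 0) (v := 1) (-t)
    rw [zero_add] at h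
    rw [← h, Measure.map_apply (measurable_add_const _) measurableSet_Ioi]
    congr 1
    ext y
    simp
  rw [hshift, ENNReal.ofReal_mul (Real.exp_nonneg _)]
  refine (gaussianReal_le_mul_of_pdf_le (m' := 0) one_ne_zero (Real.exp_nonneg _)
    measurableSet_Ioi fun y hy ↦ gaussianPDFReal_le_exp_mul ?_).trans
    (mul_le_mul_right gaussianReal_Ioi_zero_le_half _)
  have : 0 ≤ t * y := mul_nonneg ht (Set.mem_Ioi.mp hy).le
  simp only [NNReal.coe_one]
  nlinarith

lemma gaussianReal_Ioi_le_of_nonpos {t : ℝ} (ht : t ≤ 0) :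
    gaussianReal 0 1 (Set.Ioi t) ≤ ENNReal.ofReal (1 / 2 - t / 2) := by
  have hpdf (y : ℝ) : gaussianPDF 0 1 y ≤ ENNReal.ofReal (1 / 2) := by
    refine ENNReal.ofReal_le_ofReal ?_
    have hsqrt : 2 ≤ √(2 * Real.pi * (1 : NNReal)) := by
      apply Real.le_sqrt_of_sq_le
      simp only [NNReal.coe_one]
      linarith [Real.pi_gt_three]
    have hexp : Real.exp (-(y - 0) ^ 2 / (2 * (1 : NNReal))) ≤ 1 := by
      rw [Real.exp_le_one_iff]
      simp only [NNReal.coe_one]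
      nlinarith [sq_nonneg (y - 0)]
    have hinv : (√(2 * Real.pi * (1 : NNReal)))⁻¹ ≤ 1 / 2 := by
      rw [one_div]
      exact inv_anti₀ two_pos hsqrt
    calc gaussianPDFReal 0 1 y ≤ 1 / 2 * 1 :=
          mul_le_mul hinv hexp (Real.exp_nonneg _) (by norm_num)
      _ = 1 / 2 := mul_one _
  have hIoc : gaussianReal 0 1 (Set.Ioc t 0) ≤ ENNReal.ofReal (-t / 2) := by
    rw [gaussianReal_apply _ one_ne_zero]
    calc ∫⁻ y in Set.Ioc t 0, gaussianPDF 0 1 y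
        ≤ ∫⁻ _ in Set.Ioc t 0, ENNReal.ofReal (1 / 2) := lintegral_mono fun y ↦ hpdf y
      _ = ENNReal.ofReal (-t / 2) := by
        rw [setLIntegral_const, Real.volume_Ioc, ← ENNReal.ofReal_mul (by norm_num)]
        congr 1
        ring
  rw [← Set.Ioc_union_Ioi_eq_Ioi ht]
  refine (measure_union_le _ _).trans ((add_le_add hIoc gaussianReal_Ioi_zero_le_half).trans ?_)
  rw [← ENNReal.ofReal_add (by linarith) (by norm_num)]
  exact ENNReal.ofReal_le_ofReal (by linarith)

/-- The tail bound that calibrates the Gaussian mechanism. -/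
lemma gaussianReal_Ioi_sub_inv_le {δ c : ℝ} (hδ0 : 0 < δ) (hδ1 : δ < 1) (hc : 0 < c)
    (hcδ : c ^ 2 = 2 * Real.log (1.25 / δ)) :
    gaussianReal 0 1 (Set.Ioi (c - 1 / (2 * c))) ≤ ENNReal.ofReal δ := by
  have hδ : δ = 1.25 * Real.exp (-c ^ 2 / 2) := by
    rw [hcδ, show -(2 * Real.log (1.25 / δ)) / 2 = -Real.log (1.25 / δ) by ring, Real.exp_neg,
      Real.exp_log (by positivity)]
    field_simp
  have hu : c * (1 / (2 * c)) = 1 / 2 := by field_simp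
  have hu0 : 0 < 1 / (2 * c) := by positivity
  set u := 1 / (2 * c)
  rcases le_total 0 (c - u) with ht | ht
  · refine (gaussianReal_Ioi_le_of_nonneg ht).trans (ENNReal.ofReal_le_ofReal ?_)
    have hexp : Real.exp (-(c - u) ^ 2 / 2) ≤ Real.exp (1 / 2) * Real.exp (-c ^ 2 / 2) := by
      rw [← Real.exp_add, Real.exp_le_exp]
      nlinarith [sq_nonneg u]
    have hhalf : Real.exp (1 / 2) ≤ 2.5 := by
      have h : Real.exp (1 / 2) * Real.exp (1 / 2) = Real.exp 1 := by
        rw [← Real.exp_add]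
        norm_num
      nlinarith [Real.exp_one_lt_three]
    rw [hδ]
    nlinarith [Real.exp_pos (-c ^ 2 / 2)]
  · refine (gaussianReal_Ioi_le_of_nonpos ht).trans (ENNReal.ofReal_le_ofReal ?_)
    have hlog : 0.2 ≤ Real.log (1.25 / δ) := by
      refine le_trans ?_ (Real.one_sub_inv_le_log_of_pos (by positivity))
      rw [inv_div]
      norm_num at *
      linarith
    have hc6 : 0.6 ≤ c := by nlinarith
    have hδ9 : 0.9 ≤ δ := by
      have := Real.add_one_le_exp (-c ^ 2 / 2)
      nlinarith
    nlinarith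

theorem gaussian_mechanism_dp (ε δ Δ σ x x' : ℝ)
    (hε : 0 < ε) (hε1 : ε ≤ 1) (hδ0 : 0 < δ) (hδ1 : δ < 1) (hΔ : 0 < Δ)
    (hσ : Δ * Real.sqrt (2 * Real.log (1.25 / δ)) / ε ≤ σ)
    (hxx' : |x - x'| ≤ Δ) (S : Set ℝ) (hS : MeasurableSet S) :
    gaussianReal x (σ ^ 2).toNNReal S ≤
      ENNReal.ofReal (Real.exp ε) * gaussianReal x' (σ ^ 2).toNNReal S +
        ENNReal.ofReal δ := by
  have hlog : 0 < Real.log (1.25 / δ) := Real.log_pos (by rw [lt_div_iff₀ hδ0]; linarith)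
  set c := √(2 * Real.log (1.25 / δ)) with hc_def
  have hc : 0 < c := Real.sqrt_pos.mpr (by positivity)
  have hcδ : c ^ 2 = 2 * Real.log (1.25 / δ) := Real.sq_sqrt (by positivity)
  have hσ0 : 0 < σ := lt_of_lt_of_le (by positivity) hσ
  rw [div_le_iff₀ hε] at hσ
  have hvσ : ((σ ^ 2).toNNReal : ℝ) = σ ^ 2 := Real.coe_toNNReal _ (sq_nonneg σ)
  have hv : (σ ^ 2).toNNReal ≠ 0 := (Real.toNNReal_pos.mpr (by positivity)).ne'
  rcases eq_or_ne x x' with rfl | hne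
  · refine le_add_right (le_mul_of_one_le_left zero_le ?_)
    exact ENNReal.one_le_ofReal.mpr (Real.one_le_exp hε.le)
  set d := x - x' with hd
  have hd0 : 0 < |d| := abs_pos.mpr (sub_ne_zero.mpr hne)
  let B : Set ℝ := {y | 2 * σ ^ 2 * ε < 2 * (y - x) * d + d ^ 2}
  have hB : MeasurableSet B := measurableSet_lt (by fun_prop) (by fun_prop)
  have hgood : gaussianReal x (σ ^ 2).toNNReal (S \ B) ≤
      ENNReal.ofReal (Real.exp ε) * gaussianReal x' (σ ^ 2).toNNReal S := by
    refine (gaussianReal_le_mul_of_pdf_le (m' := x') hv (Real.exp_nonneg ε) (hS.diff hB)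
      fun y hy ↦ gaussianPDFReal_le_exp_mul ?_).trans
      (mul_le_mul_right (measure_mono Set.sdiff_subset) _)
    have hyB : 2 * (y - x) * d + d ^ 2 ≤ 2 * σ ^ 2 * ε := not_lt.mp hy.2
    rw [hvσ, ← sub_nonneg]
    have : ε + -(y - x') ^ 2 / (2 * σ ^ 2) - -(y - x) ^ 2 / (2 * σ ^ 2) =
        (2 * σ ^ 2 * ε - (2 * (y - x) * d + d ^ 2)) / (2 * σ ^ 2) := by
      rw [hd]
      field_simp
      ring
    rw [this]
    exact div_nonneg (by linarith) (by positivity)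
  have hlaw : (gaussianReal x (σ ^ 2).toNNReal).map (fun y ↦ d / (|d| * σ) * (y - x)) =
      gaussianReal 0 1 := by
    have h := gaussianReal_map_const_mul (μ := x - x) (v := (σ ^ 2).toNNReal) (d / (|d| * σ))
    rw [← gaussianReal_map_sub_const, Measure.map_map (by fun_prop) (by fun_prop)] at h
    refine h.trans ?_
    congr 1
    · simp
    · ext
      simp only [NNReal.coe_mul, NNReal.coe_mk, hvσ, NNReal.coe_one, div_pow, mul_pow, sq_abs]
      have : d ≠ 0 := abs_pos.mp hd0
      field_simp
  have hbad : gaussianReal x (σ ^ 2).toNNReal B ≤ ENNReal.ofReal δ := by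
    refine le_trans ?_ (gaussianReal_Ioi_sub_inv_le hδ0 hδ1 hc hcδ)
    rw [← hlaw, Measure.map_apply (by fun_prop) measurableSet_Ioi]
    refine measure_mono fun y hy ↦ ?_
    have hyB : 2 * σ ^ 2 * ε < 2 * (y - x) * d + d ^ 2 := hy
    rw [Set.mem_preimage, Set.mem_Ioi]
    have hcd : c * |d| ≤ σ * ε := by nlinarith
    have hinv : |d| / (2 * σ) ≤ 1 / (2 * c) := by
      rw [div_le_div_iff₀ (by positivity) (by positivity)]
      nlinarith
    have hc_le : c ≤ σ * ε / |d| := (le_div_iff₀ hd0).mpr hcd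
    have hlt : 0 < d / (|d| * σ) * (y - x) - (σ * ε / |d| - |d| / (2 * σ)) := by
      have : d / (|d| * σ) * (y - x) - (σ * ε / |d| - |d| / (2 * σ)) =
          (2 * (y - x) * d + |d| ^ 2 - 2 * σ ^ 2 * ε) / (2 * |d| * σ) := by
        field_simp
        ring
      rw [this, sq_abs]
      exact div_pos (by linarith) (by positivity)
    linarith
  calc gaussianReal x (σ ^ 2).toNNReal S
      ≤ gaussianReal x (σ ^ 2).toNNReal (S \ B ∪ B) :=
        measure_mono (by rw [Set.sdiff_union_self]; exact Set.subset_union_left)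
    _ ≤ _ := (measure_union_le _ _).trans (add_le_add hgood hbad)
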